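/- Let d ∈ ℕ, D ∈ (0, ∞), ε ∈ (0, ∞), and let ℝ^d be equipped with an arbitrary norm ‖·‖. Let 𝒫 be a partition of ℝ^d such that every member of 𝒫 has diameter at most D with respect to ‖·‖. Then there exists p ∈ ℝ^d such that the open ball {x : ‖x − p‖ < ε} intersects at least ⌈(1 + 2ε/D)^d⌉ members of 𝒫. -/

import Mathlib

open MeasureTheory

section PrekopaLeindler

open ENNReal Set Pointwise

theorem Real.volume_add_volume_le_of_isGreatest_of_isLeast {A B C : Set ℝ} {k l : ℝ}
    (hk : IsGreatest A k) (hl : IsLeast B l) (h : ∀ a ∈ A, ∀ b ∈ B, a + b ∈ C) :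
    volume A + volume B ≤ volume C := by
  rw [← measure_inter_add_sdiff C (measurableSet_Iic (a := k + l))]
  refine add_le_add ?_ ?_
  · rw [← measure_preimage_add_right volume l (C ∩ Iic (k + l))]
    refine measure_mono fun a ha => ⟨h a ha l hl.1, ?_⟩
    simpa using hk.2 ha
  · rw [← measure_preimage_add volume k (C \ Iic (k + l)),
      ← measure_sdiff_null (s := B) (t := {l}) (by simp)]
    refine measure_mono fun b hb => ⟨h k hk.1 b hb.1, ?_⟩
    simpa using lt_of_le_of_ne (hl.2 hb.1) (Ne.symm hb.2)

/-- The one-dimensional Brunn–Minkowski inequality. -/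
theorem Real.volume_add_volume_le {A B C : Set ℝ} (hA : MeasurableSet A) (hB : MeasurableSet B)
    (hA' : A.Nonempty) (hB' : B.Nonempty) (h : ∀ a ∈ A, ∀ b ∈ B, a + b ∈ C) :
    volume A + volume B ≤ volume C := by
  obtain ⟨a₀, ha₀⟩ := hA'
  obtain ⟨b₀, hb₀⟩ := hB'
  rw [hA.measure_eq_iSup_isCompact, hB.measure_eq_iSup_isCompact]
  simp only [iSup_and']
  refine ENNReal.biSup_add_biSup_le' ⟨∅, by simp⟩ ⟨∅, by simp⟩ fun K hK L hL => ?_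
  have hKc : IsCompact (insert a₀ K) := hK.2.insert a₀
  have hLc : IsCompact (insert b₀ L) := hL.2.insert b₀
  obtain ⟨k, hk⟩ := hKc.exists_isGreatest (insert_nonempty _ _)
  obtain ⟨l, hl⟩ := hLc.exists_isLeast (insert_nonempty _ _)
  calc volume K + volume L ≤ volume (insert a₀ K) + volume (insert b₀ L) := by
        gcongr <;> exact subset_insert _ _
    _ ≤ volume C := volume_add_volume_le_of_isGreatest_of_isLeast hk hl fun a ha b hb =>
        h a (insert_subset ha₀ hK.1 ha) b (insert_subset hb₀ hL.1 hb)

theorem Real.ofReal_mul_volume_add_le {t s : ℝ} (ht : 0 < t) (hs : 0 < s) {A B C : Set ℝ}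
    (hA : MeasurableSet A) (hB : MeasurableSet B)
    (hA' : A.Nonempty) (hB' : B.Nonempty) (h : ∀ a ∈ A, ∀ b ∈ B, t * a + s * b ∈ C) :
    ENNReal.ofReal t * volume A + ENNReal.ofReal s * volume B ≤ volume C := by
  have := Real.volume_add_volume_le (A := t • A) (B := s • B) (C := C)
    (hA.const_smul₀ t) (hB.const_smul₀ s) (hA'.smul_set) (hB'.smul_set) (by
      rintro _ ⟨a, ha, rfl⟩ _ ⟨b, hb, rfl⟩
      exact h a ha b hb)
  simpa [Measure.addHaar_smul, abs_of_pos ht, abs_of_pos hs] using this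

open ENNReal in
theorem ENNReal.geom_mean_le_arith_mean2_weighted {t s : ℝ} (ht : 0 < t) (hs : 0 < s)
    (hts : t + s = 1) (a b : ℝ≥0∞) :
    a ^ t * b ^ s ≤ ENNReal.ofReal t * a + ENNReal.ofReal s * b := by
  rcases eq_or_ne a ∞ with rfl | ha
  · simp [ENNReal.mul_top, ht]
  rcases eq_or_ne b ∞ with rfl | hb
  · simp [ENNReal.mul_top, hs]
  lift a to NNReal using ha
  lift b to NNReal using hb
  lift t to NNReal using ht.le
  lift s to NNReal using hs.le
  rw [← ENNReal.coe_rpow_of_nonneg _ ht.le, ← ENNReal.coe_rpow_of_nonneg _ hs.le]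
  simp only [ENNReal.ofReal_coe_nnreal]
  exact_mod_cast NNReal.geom_mean_le_arith_mean2_weighted t s a b (by exact_mod_cast hts)

open ENNReal in
theorem ENNReal.rpow_mul_rpow_self {t s : ℝ} (hts : t + s = 1) (x : ℝ≥0∞) (ht : 0 < t)
    (hs : 0 < s) : x ^ t * x ^ s = x := by
  rw [← ENNReal.rpow_add_of_nonneg _ _ ht.le hs.le, hts, ENNReal.rpow_one]

theorem lintegral_eq_lintegral_meas_ofReal_lt {α : Type*} [MeasurableSpace α] (μ : Measure α)
    {f : α → ℝ≥0∞} (hf : Measurable f) (hf1 : ∀ x, f x ≠ ∞) :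
    ∫⁻ x, f x ∂μ = ∫⁻ u in Ioi (0 : ℝ), μ {x | ENNReal.ofReal u < f x} := by
  have h := lintegral_eq_lintegral_meas_lt μ (f := fun x => (f x).toReal)
    (Filter.Eventually.of_forall fun _ => ENNReal.toReal_nonneg) hf.ennreal_toReal.aemeasurable
  simp only [ENNReal.ofReal_toReal (hf1 _)] at h
  rw [h]
  refine setLIntegral_congr_fun measurableSet_Ioi fun u hu => ?_
  congr 1
  ext x
  exact (ENNReal.ofReal_lt_iff_lt_toReal (le_of_lt hu) (hf1 x)).symm

theorem Real.lintegral_add_le_of_iSup_eq_one {t s : ℝ} (ht : 0 < t) (hs : 0 < s)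
    (hts : t + s = 1) {f g h : ℝ → ℝ≥0∞} (hf : Measurable f) (hg : Measurable g)
    (hh : Measurable h) (hf1 : ⨆ x, f x = 1) (hg1 : ⨆ x, g x = 1)
    (H : ∀ x y, f x ^ t * g y ^ s ≤ h (t * x + s * y)) :
    ENNReal.ofReal t * (∫⁻ x, f x) + ENNReal.ofReal s * (∫⁻ x, g x) ≤ ∫⁻ x, h x := by
  have hf1' : ∀ x, f x ≤ 1 := fun x => hf1 ▸ le_iSup f x
  have hg1' : ∀ x, g x ≤ 1 := fun x => hg1 ▸ le_iSup g x
  have hh' : ∫⁻ x, min (h x) 1 ≤ ∫⁻ x, h x := lintegral_mono fun x => min_le_left _ _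
  refine le_trans ?_ hh'
  rw [lintegral_eq_lintegral_meas_ofReal_lt volume hf fun x => ((hf1' x).trans_lt one_lt_top).ne,
    lintegral_eq_lintegral_meas_ofReal_lt volume hg fun x => ((hg1' x).trans_lt one_lt_top).ne,
    lintegral_eq_lintegral_meas_ofReal_lt volume (hh.min measurable_const)
      fun x => ((min_le_right _ _).trans_lt one_lt_top).ne,
    ← lintegral_const_mul' _ _ ofReal_ne_top, ← lintegral_const_mul' _ _ ofReal_ne_top]
  refine (le_lintegral_add _ _).trans (lintegral_mono fun u => ?_)
  rcases lt_or_ge (ENNReal.ofReal u) 1 with hu | hu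
  · refine Real.ofReal_mul_volume_add_le ht hs (measurableSet_lt measurable_const hf)
      (measurableSet_lt measurable_const hg) ?_ ?_ fun a ha b hb => ?_
    · exact lt_iSup_iff.1 (hf1 ▸ hu)
    · exact lt_iSup_iff.1 (hg1 ▸ hu)
    · refine lt_min (lt_of_lt_of_le ?_ (H a b)) hu
      rw [← ENNReal.rpow_mul_rpow_self hts (ENNReal.ofReal u) ht hs]
      exact ENNReal.mul_lt_mul (ENNReal.rpow_lt_rpow ha ht) (ENNReal.rpow_lt_rpow hb hs)
  · have hF : {x | ENNReal.ofReal u < f x} = ∅ := by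
      ext x; simpa using (hf1' x).trans hu
    have hG : {x | ENNReal.ofReal u < g x} = ∅ := by
      ext x; simpa using (hg1' x).trans hu
    simp [hF, hG]

theorem Real.prekopa_leindler_of_iSup_ne_top {t s : ℝ} (ht : 0 < t) (hs : 0 < s)
    (hts : t + s = 1) {f g h : ℝ → ℝ≥0∞} (hf : Measurable f) (hg : Measurable g)
    (hh : Measurable h) (hf1 : ⨆ x, f x ≠ ∞) (hg1 : ⨆ x, g x ≠ ∞)
    (H : ∀ x y, f x ^ t * g y ^ s ≤ h (t * x + s * y)) :
    (∫⁻ x, f x) ^ t * (∫⁻ x, g x) ^ s ≤ ∫⁻ x, h x := by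
  rcases eq_or_ne (⨆ x, f x) 0 with hf0 | hf0
  · have : ∀ x, f x = 0 := by simpa using hf0
    simp [this, ht]
  rcases eq_or_ne (⨆ x, g x) 0 with hg0 | hg0
  · have : ∀ x, g x = 0 := by simpa using hg0
    simp [this, hs]
  set a := ⨆ x, f x
  set b := ⨆ x, g x
  have hc0 : a ^ t * b ^ s ≠ 0 := by simp [hf0, hg0, hf1, hg1]
  have hct : a ^ t * b ^ s ≠ ∞ :=
    ENNReal.mul_ne_top (rpow_ne_top_of_nonneg ht.le hf1) (rpow_ne_top_of_nonneg hs.le hg1)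
  have key (x y : ℝ≥0∞) : (x / a) ^ t * (y / b) ^ s = x ^ t * y ^ s / (a ^ t * b ^ s) := by
    rw [ENNReal.div_rpow_of_nonneg _ _ ht.le, ENNReal.div_rpow_of_nonneg _ _ hs.le,
      ENNReal.mul_div_mul_comm]
    · simp [hf0, hf1]
    · simp [hg0, hg1]
  have := Real.lintegral_add_le_of_iSup_eq_one ht hs hts (f := fun x => f x / a)
    (g := fun x => g x / b) (h := fun x => h x / (a ^ t * b ^ s)) (hf.div_const _)
    (hg.div_const _) (hh.div_const _)
    (by rw [← ENNReal.iSup_div, ENNReal.div_self hf0 hf1])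
    (by rw [← ENNReal.iSup_div, ENNReal.div_self hg0 hg1])
    (fun x y => by rw [key]; exact ENNReal.div_le_div_right (H x y) _)
  have := (ENNReal.geom_mean_le_arith_mean2_weighted ht hs hts _ _).trans this
  simp only [div_eq_mul_inv] at this
  rw [lintegral_mul_const _ hf, lintegral_mul_const _ hg, lintegral_mul_const _ hh] at this
  simp only [← div_eq_mul_inv] at this
  rw [key] at this
  rwa [ENNReal.div_le_iff hc0 hct, ENNReal.div_mul_cancel hc0 hct] at this

theorem lintegral_eq_iSup_lintegral_min_natCast {α : Type*} [MeasurableSpace α] (μ : Measure α)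
    {f : α → ℝ≥0∞} (hf : Measurable f) :
    ∫⁻ x, f x ∂μ = ⨆ n : ℕ, ∫⁻ x, min (f x) n ∂μ := by
  rw [← lintegral_iSup (fun n => hf.min measurable_const)]
  · refine lintegral_congr fun x => ?_
    rw [← inf_iSup_eq, ENNReal.iSup_natCast, inf_top_eq]
  · intro n m hnm x
    exact min_le_min_left _ (by exact_mod_cast hnm)

/-- The one-dimensional Prékopa–Leindler inequality. -/
theorem Real.prekopa_leindler {t s : ℝ} (ht : 0 < t) (hs : 0 < s)
    (hts : t + s = 1) {f g h : ℝ → ℝ≥0∞} (hf : Measurable f) (hg : Measurable g)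
    (hh : Measurable h) (H : ∀ x y, f x ^ t * g y ^ s ≤ h (t * x + s * y)) :
    (∫⁻ x, f x) ^ t * (∫⁻ x, g x) ^ s ≤ ∫⁻ x, h x := by
  have iSup_rpow (r : ℝ) (hr : 0 < r) (F : ℕ → ℝ≥0∞) : (⨆ n, F n) ^ r = ⨆ n, F n ^ r :=
    (ENNReal.orderIsoRpow r hr).map_iSup F
  rw [lintegral_eq_iSup_lintegral_min_natCast volume hf,
    lintegral_eq_iSup_lintegral_min_natCast volume hg, iSup_rpow t ht, iSup_rpow s hs,
    ENNReal.iSup_mul]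
  refine iSup_le fun n => ?_
  rw [ENNReal.mul_iSup]
  refine iSup_le fun m => ?_
  refine Real.prekopa_leindler_of_iSup_ne_top ht hs hts (hf.min measurable_const)
    (hg.min measurable_const) hh ?_ ?_ fun x y => le_trans ?_ (H x y)
  · exact ((iSup_le fun x => min_le_right _ _).trans_lt (natCast_lt_top n)).ne
  · exact ((iSup_le fun x => min_le_right _ _).trans_lt (natCast_lt_top m)).ne
  · gcongr <;> exact min_le_left _ _

theorem lintegral_fin_succ {n : ℕ} {f : (Fin (n + 1) → ℝ) → ℝ≥0∞} (hf : Measurable f) :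
    ∫⁻ x, f x = ∫⁻ x : ℝ, ∫⁻ y : Fin n → ℝ, f (Fin.cons x y) := by
  have e := (volume_preserving_piFinSuccAbove (fun _ : Fin (n + 1) => ℝ) 0).symm
  rw [← e.lintegral_comp hf, Measure.volume_eq_prod, lintegral_prod]
  · simp only [MeasurableEquiv.piFinSuccAbove_symm_apply, Fin.insertNthEquiv_zero]
    rfl
  · exact (hf.comp e.measurable).aemeasurable

/-- The Prékopa–Leindler inequality. -/
theorem prekopa_leindler {t s : ℝ} (ht : 0 < t) (hs : 0 < s) (hts : t + s = 1) {n : ℕ}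
    {f g h : (Fin n → ℝ) → ℝ≥0∞} (hf : Measurable f) (hg : Measurable g)
    (hh : Measurable h) (H : ∀ x y, f x ^ t * g y ^ s ≤ h (t • x + s • y)) :
    (∫⁻ x, f x) ^ t * (∫⁻ x, g x) ^ s ≤ ∫⁻ x, h x := by
  induction n with
  | zero =>
    rw [lintegral_unique, lintegral_unique, lintegral_unique]
    simp only [volume_pi, Measure.pi_univ, Finset.univ_eq_empty, Finset.prod_empty, mul_one]
    convert H default default
  | succ n ih =>
    rw [lintegral_fin_succ hf, lintegral_fin_succ hg, lintegral_fin_succ hh]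
    have hcons : Measurable fun p : ℝ × (Fin n → ℝ) => (Fin.cons p.1 p.2 : Fin (n + 1) → ℝ) := by
      simpa [Fin.consEquiv, Fin.insertNthEquiv_zero] using
      (MeasurableEquiv.piFinSuccAbove (fun _ : Fin (n + 1) => ℝ) 0).symm.measurable
    refine Real.prekopa_leindler ht hs hts (hf.comp hcons).lintegral_prod_right'
      (hg.comp hcons).lintegral_prod_right' (hh.comp hcons).lintegral_prod_right' fun x y => ?_
    refine ih (hf.comp (hcons.comp measurable_prodMk_left))
      (hg.comp (hcons.comp measurable_prodMk_left))
      (hh.comp (hcons.comp measurable_prodMk_left)) fun x' y' => ?_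
    refine (H (Fin.cons x x') (Fin.cons y y')).trans_eq ?_
    congr 1
    ext i
    refine Fin.cases ?_ (fun j => ?_) i <;> simp

/-- The multiplicative form of the Brunn–Minkowski inequality. -/
theorem volume_rpow_mul_volume_rpow_le {t s : ℝ} (ht : 0 < t) (hs : 0 < s) (hts : t + s = 1)
    {n : ℕ} {A B C : Set (Fin n → ℝ)} (hA : MeasurableSet A) (hB : MeasurableSet B)
    (hC : MeasurableSet C) (h : ∀ a ∈ A, ∀ b ∈ B, t • a + s • b ∈ C) :
    volume A ^ t * volume B ^ s ≤ volume C := by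
  rw [← lintegral_indicator_one hA, ← lintegral_indicator_one hB, ← lintegral_indicator_one hC]
  refine prekopa_leindler ht hs hts (measurable_one.indicator hA) (measurable_one.indicator hB)
    (measurable_one.indicator hC) fun x y => ?_
  by_cases hx : x ∈ A
  · by_cases hy : y ∈ B
    · simp [hx, hy, h x hx y hy]
    · simp [hy, hs]
  · simp [hx, ht]

end PrekopaLeindler

namespace Seminorm

variable {d : ℕ}

theorem continuous_of_pi (p : Seminorm ℝ (Fin d → ℝ)) : Continuous p :=
  p.convexOn.locallyLipschitz.continuous

theorem isOpen_ball_of_pi (p : Seminorm ℝ (Fin d → ℝ)) (x : Fin d → ℝ) (r : ℝ) :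
    IsOpen (p.ball x r) :=
  isOpen_lt (p.continuous_of_pi.comp (continuous_id.sub continuous_const)) continuous_const

theorem isCompact_closedBall_of_pi (p : Seminorm ℝ (Fin d → ℝ)) (hp : ∀ x, p x = 0 → x = 0)
    (r : ℝ) : IsCompact (p.closedBall 0 r) := by
  obtain ⟨c, hc, hcp⟩ := (isCompact_sphere (0 : Fin d → ℝ) 1).exists_forall_le'
    p.continuous_of_pi.continuousOn (a := 0) fun x hx =>
      lt_of_le_of_ne (apply_nonneg p x) fun h => by
        simp [hp x h.symm] at hx
  have hnorm (x : Fin d → ℝ) : c * ‖x‖ ≤ p x := by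
    rcases eq_or_ne x 0 with rfl | hx
    · simp
    have hx' : 0 < ‖x‖ := norm_pos_iff.2 hx
    have := hcp (‖x‖⁻¹ • x) (by simp [norm_smul, hx'.ne'])
    rw [map_smul_eq_mul, norm_inv, norm_norm, inv_mul_eq_div, le_div_iff₀ hx'] at this
    exact this
  refine (isCompact_closedBall (0 : Fin d → ℝ) (r / c)).of_isClosed_subset ?_ fun x hx => ?_
  · simpa [closedBall_zero_eq] using isClosed_le p.continuous_of_pi continuous_const
  · rw [mem_closedBall_zero] at hx
    rw [mem_closedBall_zero_iff, le_div_iff₀ hc, mul_comm]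
    exact (hnorm x).trans hx

theorem volume_ball_lt_top (p : Seminorm ℝ (Fin d → ℝ)) (hp : ∀ x, p x = 0 → x = 0)
    (r : ℝ) : volume (p.ball 0 r) < ⊤ :=
  (measure_mono (p.ball_subset_closedBall 0 r)).trans_lt
    (p.isCompact_closedBall_of_pi hp r).measure_lt_top

theorem volume_ball_pos (p : Seminorm ℝ (Fin d → ℝ)) {r : ℝ} (hr : 0 < r) :
    0 < volume (p.ball 0 r) :=
  (p.isOpen_ball_of_pi 0 r).measure_pos _ ⟨0, by simpa using hr⟩

theorem volume_ball_eq (p : Seminorm ℝ (Fin d → ℝ)) {r : ℝ} (hr : 0 < r) :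
    volume (p.ball 0 r) = ENNReal.ofReal (r ^ d) * volume (p.ball 0 1) := by
  have h := smul_ball_zero (p := p) (k := r) (r := 1) hr.ne'
  rw [Real.norm_of_nonneg hr.le, mul_one] at h
  rw [← h, Measure.addHaar_smul_of_nonneg _ hr.le]
  simp

/-- The isodiametric inequality for a norm on `ℝ^d`. -/
theorem volume_le_of_forall_sub_le (p : Seminorm ℝ (Fin d → ℝ)) (hp : ∀ x, p x = 0 → x = 0)
    {D : ℝ} (hD : 0 < D) {K : Set (Fin d → ℝ)} (hK : MeasurableSet K)
    (hKD : ∀ x ∈ K, ∀ y ∈ K, p (x - y) ≤ D) :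
    volume K ≤ ENNReal.ofReal ((D / 2) ^ d) * volume (p.ball 0 1) := by
  have hlim : Filter.Tendsto (fun r : ℝ => ENNReal.ofReal (r ^ d) * volume (p.ball 0 1))
      (nhdsWithin (D / 2) (Set.Ioi (D / 2)))
      (nhds (ENNReal.ofReal ((D / 2) ^ d) * volume (p.ball 0 1))) := by
    refine ENNReal.Tendsto.mul_const (ENNReal.tendsto_ofReal ?_)
      (Or.inr (p.volume_ball_lt_top hp 1).ne)
    exact ((continuous_pow d).tendsto _).mono_left nhdsWithin_le_nhds
  refine ge_of_tendsto hlim (Filter.eventually_of_mem self_mem_nhdsWithin fun r hr => ?_)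
  rw [Set.mem_Ioi] at hr
  rw [← p.volume_ball_eq (by linarith)]
  have h := volume_rpow_mul_volume_rpow_le (t := 1 / 2) (s := 1 / 2) (by norm_num) (by norm_num)
    (by norm_num) hK hK.neg (p.isOpen_ball_of_pi 0 r).measurableSet fun a ha b hb => by
      rw [mem_ball_zero, ← smul_add, map_smul_eq_mul, Real.norm_of_nonneg (by norm_num)]
      have := hKD a ha (-b) hb
      rw [sub_neg_eq_add] at this
      linarith
  rwa [Measure.measure_neg, ENNReal.rpow_mul_rpow_self (by norm_num) _ (by norm_num)
    (by norm_num)] at h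

open Pointwise in
theorem ofReal_mul_volume_le_volume_thickening (p : Seminorm ℝ (Fin d → ℝ))
    (hp : ∀ x, p x = 0 → x = 0) {D ε : ℝ} (hD : 0 < D) (hε : 0 < ε) {K U : Set (Fin d → ℝ)}
    (hK : MeasurableSet K) (hU : MeasurableSet U) (hKD : ∀ x ∈ K, ∀ y ∈ K, p (x - y) ≤ D)
    (hKU : ∀ x ∈ K, ∀ y, p (y - x) < ε → y ∈ U) :
    ENNReal.ofReal ((1 + 2 * ε / D) ^ d) * volume K ≤ volume U := by
  have hc : 0 < 1 + 2 * ε / D := by positivity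
  set c := 1 + 2 * ε / D with hc_def
  have ht : 0 < c⁻¹ := by positivity
  have hs_eq : 1 - c⁻¹ = 2 * ε / (D + 2 * ε) := by rw [hc_def]; field_simp; ring
  have hs : 0 < 1 - c⁻¹ := by rw [hs_eq]; positivity
  have hρ_eq : (D + 2 * ε) / 2 = c * (D / 2) := by rw [hc_def]; field_simp
  have hρ : 0 < c * (D / 2) := by positivity
  have h := volume_rpow_mul_volume_rpow_le ht hs (by ring) (A := c • K)
    (B := p.ball 0 (c * (D / 2))) (C := U) (hK.const_smul₀ c)
    (p.isOpen_ball_of_pi 0 _).measurableSet hU (by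
      rintro _ ⟨k, hk, rfl⟩ b hb
      refine hKU k hk _ ?_
      rw [mem_ball_zero] at hb
      simp only [smul_smul, inv_mul_cancel₀ hc.ne', one_smul, add_sub_cancel_left]
      rw [map_smul_eq_mul, Real.norm_of_nonneg hs.le]
      calc (1 - c⁻¹) * p b < (1 - c⁻¹) * (c * (D / 2)) := by gcongr
        _ = ε := by rw [hs_eq, ← hρ_eq]; field_simp)
  rw [p.volume_ball_eq hρ, mul_pow, ENNReal.ofReal_mul (by positivity), mul_assoc,
    Measure.addHaar_smul_of_nonneg _ hc.le, Module.finrank_fin_fun] at h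
  calc ENNReal.ofReal (c ^ d) * volume K
      = (ENNReal.ofReal (c ^ d) * volume K) ^ c⁻¹ *
          (ENNReal.ofReal (c ^ d) * volume K) ^ (1 - c⁻¹) :=
        (ENNReal.rpow_mul_rpow_self (add_sub_cancel _ _) _ ht hs).symm
    _ ≤ _ := by
        gcongr
        exact p.volume_le_of_forall_sub_le hp hD hK hKD
    _ ≤ volume U := h

end Seminorm

theorem MeasureTheory.sum_measure_le_mul_of_card_le {α ι : Type*} [MeasurableSpace α]
    (μ : Measure α) (F : Finset ι) {U : ι → Set α} {B : Set α} {m : ℕ}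
    (hU : ∀ i ∈ F, MeasurableSet (U i)) (hB : MeasurableSet B) (hUB : ∀ i ∈ F, U i ⊆ B)
    (hm : ∀ x, ∀ S ⊆ F, (∀ i ∈ S, x ∈ U i) → S.card ≤ m) :
    ∑ i ∈ F, μ (U i) ≤ m * μ B := by
  classical
  calc ∑ i ∈ F, μ (U i) = ∑ i ∈ F, ∫⁻ x, (U i).indicator 1 x ∂μ :=
        Finset.sum_congr rfl fun i hi => (lintegral_indicator_one (hU i hi)).symm
    _ = ∫⁻ x, ∑ i ∈ F, (U i).indicator 1 x ∂μ :=
        (lintegral_finsetSum' _ fun i hi => (measurable_one.indicator (hU i hi)).aemeasurable).symm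
    _ ≤ ∫⁻ x, B.indicator (fun _ => (m : ENNReal)) x ∂μ := by
        refine lintegral_mono fun x => ?_
        by_cases hx : x ∈ B
        · have := hm x (F.filter fun i => x ∈ U i) (Finset.filter_subset _ _) (by simp)
          simp only [Set.indicator_apply, Pi.one_apply, hx, if_true, Finset.sum_boole]
          exact_mod_cast this
        · rw [Set.indicator_of_notMem hx]
          exact (Finset.sum_eq_zero fun i hi =>
            Set.indicator_of_notMem (fun h => hx (hUB i hi h)) _).le
    _ = m * μ B := by rw [lintegral_indicator_const hB]

theorem Seminorm.exists_lt_card_of_cover {d : ℕ} (p : Seminorm ℝ (Fin d → ℝ))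
    (hp : ∀ x, p x = 0 → x = 0) {D ε : ℝ} (hD : 0 < D) (hε : 0 < ε)
    {P : Set (Set (Fin d → ℝ))} (hP : ∀ x, ∃ X ∈ P, x ∈ X)
    (hdiam : ∀ X ∈ P, ∀ x ∈ X, ∀ y ∈ X, p (x - y) ≤ D) {m : ℕ}
    (hm : (m : ℝ) < (1 + 2 * ε / D) ^ d) :
    ∃ x : Fin d → ℝ, ∃ S : Finset (Set (Fin d → ℝ)), ↑S ⊆ P ∧ m < S.card ∧
      ∀ X ∈ S, (X ∩ p.ball x ε).Nonempty := by
  classical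
  by_contra! hcon
  replace hcon (x : Fin d → ℝ) (S : Finset (Set (Fin d → ℝ))) (hS : ↑S ⊆ P)
      (hSx : ∀ X ∈ S, (X ∩ p.ball x ε).Nonempty) : S.card ≤ m := by
    by_contra! h
    obtain ⟨X, hX, hX'⟩ := hcon x S hS h
    exact (hSx X hX).ne_empty hX'
  have hlf : LocallyFinite fun X : P => (X : Set (Fin d → ℝ)) := by
    intro x
    refine ⟨p.ball x ε, (p.isOpen_ball_of_pi x ε).mem_nhds (by simpa using hε), ?_⟩
    by_contra hinf
    obtain ⟨S, hS, hSc⟩ := Set.Infinite.exists_subset_card_eq hinf (m + 1)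
    have := hcon x (S.map (Function.Embedding.subtype _)) (by simp) (by
      simp only [Finset.mem_map, Function.Embedding.coe_subtype, forall_exists_index, and_imp]
      rintro _ X hX rfl
      exact hS hX)
    rw [Finset.card_map] at this
    omega
  have hcont := p.continuous_of_pi
  set U : Set (Fin d → ℝ) → Set (Fin d → ℝ) := fun X => {y | ∃ x ∈ X, p (y - x) < ε} with hU_def
  have hU (X) : IsOpen (U X) := by
    have : U X = ⋃ x ∈ X, p.ball x ε := by
      ext y; simp [hU_def, mem_ball]
    rw [this]
    exact isOpen_biUnion fun x _ => p.isOpen_ball_of_pi x ε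
  have hexp (X) (hX : X ∈ P) :
      ENNReal.ofReal ((1 + 2 * ε / D) ^ d) * volume X ≤ volume (U X) := by
    refine le_trans (by gcongr; exact subset_closure)
      (p.ofReal_mul_volume_le_volume_thickening hp hD hε
        (isClosed_closure (s := X)).measurableSet (hU X).measurableSet ?_ ?_)
    · have h₁ : ∀ x ∈ X, ∀ y ∈ closure X, p (x - y) ≤ D := fun x hx =>
        closure_minimal (hdiam X hX x hx)
          (isClosed_le (f := fun y => p (x - y)) (by fun_prop) continuous_const)
      exact fun x hx y hy => closure_minimal (fun x hx => h₁ x hx y hy)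
        (isClosed_le (f := fun x => p (x - y)) (by fun_prop) continuous_const) hx
    · intro x hx y hxy
      obtain ⟨z, hz, hzX⟩ := mem_closure_iff.1 hx {z | p (y - z) < ε}
        (isOpen_lt (by fun_prop) continuous_const) hxy
      exact ⟨z, hzX, hz⟩
  have hmain (R : ℝ) (hR : 0 < R) :
      (1 + 2 * ε / D) ^ d * R ^ d ≤ m * (R + (D + ε)) ^ d := by
    have hfin := hlf.finite_nonempty_inter_compact (p.isCompact_closedBall_of_pi hp R)
    set F := hfin.toFinset.map (Function.Embedding.subtype _)
    have hF (X) : X ∈ F ↔ X ∈ P ∧ (X ∩ p.closedBall 0 R).Nonempty := by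
      simp [F, and_comm]
    have hsum : ∑ X ∈ F, volume (U X) ≤ m * volume (p.ball 0 (R + (D + ε))) := by
      refine sum_measure_le_mul_of_card_le volume F (fun X _ => (hU X).measurableSet)
        (p.isOpen_ball_of_pi _ _).measurableSet ?_ ?_
      · rintro X hX y ⟨x, hx, hyx⟩
        obtain ⟨hXP, z, hzX, hz⟩ := (hF X).1 hX
        rw [mem_closedBall_zero] at hz
        rw [mem_ball_zero]
        have h₁ := hdiam X hXP x hx z hzX
        have h₂ := map_add_le_add p (y - x + (x - z)) z
        have h₃ := map_add_le_add p (y - x) (x - z)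
        rw [sub_add_sub_cancel, sub_add_cancel] at h₂
        rw [sub_add_sub_cancel] at h₃
        linarith
      · intro y S hS hy
        refine hcon y S (fun X hX => ((hF X).1 (hS hX)).1) fun X hX => ?_
        obtain ⟨x, hx, hyx⟩ := hy X hX
        exact ⟨x, hx, by rwa [mem_ball, map_sub_rev]⟩
    have hcover : volume (p.ball 0 R) ≤ ∑ X ∈ F, volume X := by
      refine (measure_mono fun x hx => ?_).trans (measure_biUnion_finset_le F id)
      obtain ⟨X, hX, hxX⟩ := hP x
      exact Set.mem_biUnion ((hF X).2 ⟨hX, x, hxX, p.ball_subset_closedBall _ _ hx⟩) hxX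
    have hv0 := (p.volume_ball_pos one_pos).ne'
    have hvt := (p.volume_ball_lt_top hp 1).ne
    have : ENNReal.ofReal ((1 + 2 * ε / D) ^ d) * volume (p.ball 0 R) ≤
        m * volume (p.ball 0 (R + (D + ε))) :=
      calc _ ≤ ENNReal.ofReal ((1 + 2 * ε / D) ^ d) * ∑ X ∈ F, volume X := by gcongr
        _ = ∑ X ∈ F, ENNReal.ofReal ((1 + 2 * ε / D) ^ d) * volume X := Finset.mul_sum _ _ _
        _ ≤ ∑ X ∈ F, volume (U X) := Finset.sum_le_sum fun X hX => hexp X ((hF X).1 hX).1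
        _ ≤ _ := hsum
    rw [p.volume_ball_eq hR, p.volume_ball_eq (by positivity : 0 < R + (D + ε)), ← mul_assoc,
      ← mul_assoc, ENNReal.mul_le_mul_iff_left hv0 hvt, ← ENNReal.ofReal_natCast,
      ← ENNReal.ofReal_mul (by positivity), ← ENNReal.ofReal_mul (by positivity),
      ENNReal.ofReal_le_ofReal_iff (by positivity)] at this
    exact this
  have hlim : Filter.Tendsto (fun R : ℝ => m * (1 + (D + ε) / R) ^ d) Filter.atTop
      (nhds (m * (1 + 0) ^ d)) :=
    (((tendsto_const_nhds.div_atTop Filter.tendsto_id).const_add 1).pow d).const_mul _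
  have hle : (1 + 2 * ε / D) ^ d ≤ m * (1 + 0) ^ d := by
    refine ge_of_tendsto hlim ((Filter.eventually_gt_atTop 0).mono fun R hR => ?_)
    have h := hmain R hR
    rw [← le_div_iff₀ (by positivity), mul_div_assoc (m : ℝ), ← div_pow, add_div,
      div_self hR.ne'] at h
    exact h
  rw [add_zero, one_pow, mul_one] at hle
  exact absurd hm hle.not_gt

/-- ε-neighborhoods for diameter-bounded partitions with respect to an arbitrary norm `N` on
`ℝ^d` (modeled as `Fin d → ℝ`): if every member of the partition `P` has `N`-diameter at most
`D`, then for every `ε > 0` there is a point `p` whose open `N`-ball of radius `ε` intersects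
at least `⌈(1 + 2ε/D)^d⌉` members of `P`. -/
theorem neighborhood_lower_bound_diameter_bounded_any_norm
    (d : ℕ) (hd : 0 < d) (D : ℝ) (hD : 0 < D)
    (N : (Fin d → ℝ) → ℝ)
    (hN0 : ∀ x, N x = 0 ↔ x = 0)
    (hN1 : ∀ (a : ℝ) (x : Fin d → ℝ), N (a • x) = |a| * N x)
    (hN2 : ∀ x y : Fin d → ℝ, N (x + y) ≤ N x + N y)
    (P : Set (Set (Fin d → ℝ))) (hP : Setoid.IsPartition P)
    (hdiam : ∀ X ∈ P, ∀ x ∈ X, ∀ y ∈ X, N (x - y) ≤ D)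
    (ε : ℝ) (hε : 0 < ε) :
    ∃ p : Fin d → ℝ, ∃ 𝒮 : Finset (Set (Fin d → ℝ)),
      ↑𝒮 ⊆ P ∧
      ⌈(1 + 2 * ε / D) ^ d⌉₊ ≤ 𝒮.card ∧
      ∀ X ∈ 𝒮, (X ∩ {x : Fin d → ℝ | N (x - p) < ε}).Nonempty := by
  let p : Seminorm ℝ (Fin d → ℝ) := Seminorm.of N hN2 hN1
  have hlt : ((⌈(1 + 2 * ε / D) ^ d⌉₊ - 1 : ℕ) : ℝ) < (1 + 2 * ε / D) ^ d :=
    Nat.lt_ceil.1 (Nat.sub_lt (Nat.ceil_pos.2 (by positivity)) one_pos)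
  obtain ⟨x, S, hSP, hS, hSx⟩ := p.exists_lt_card_of_cover (fun x => (hN0 x).1) hD hε
    (fun x => (hP.2 x).exists) hdiam hlt
  exact ⟨x, S, hSP, Nat.le_of_pred_lt hS, hSx⟩
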